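/- Fix a field k of characteristic zero and let (A, ℬ, d) be a connected cochain cdga over k which is a Sullivan algebra: there is a family of homogeneous elements (x_α)_{α ∈ I} of positive degree indexed by a well-ordered set I such that A is free graded-commutative on the x_α (the canonical algebra map from the tensor product of the polynomial algebra on the even-degree x_α and the exterior algebra on the odd-degree x_α to A is an isomorphism of graded algebras), and d(x_α) lies in the subalgebra generated by the x_β with β < α, for every α. Then the set of cdga automorphisms of A (k-algebra automorphisms preserving each ℬ i and commuting with d) that are homotopic to the identity is a normal subgroup of the group of all cdga automorphisms of A. -/

import Mathlib

open TensorProduct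

/-- The degree-`n` piece of an `ℕ`-graded space, for an integer `n`
(zero in negative degrees). -/
def gpiece {k A : Type*} [Field k] [Ring A] [Algebra k A]
    (ℬ : ℕ → Submodule k A) (n : ℤ) : Submodule k A :=
  if 0 ≤ n then ℬ n.toNat else ⊥

/-- Apply a linear map to a polynomial coefficientwise. -/
noncomputable def cmap {k A : Type*} [Field k] [Ring A] [Algebra k A]
    (f : A →ₗ[k] A) (p : Polynomial A) : Polynomial A :=
  p.sum fun n a => Polynomial.C (f a) * Polynomial.X ^ n

/-- `F₁ : A → A` is homotopic to the identity through the concrete model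
`A[t,dt] = A[t] ⊕ A[t]·dt`: there is a dga homomorphism `Φ = F + G·dt : A → A[t,dt]`
(`F, G : A → A[t]`, with the multiplication rule `dt·a = (−1)^{|a|} a·dt` encoded by the
sign involution `σ`, and differential `d(a·t^n) = d(a)·t^n + (−1)^{|a|}·n·a·t^{n−1}·dt`,
`d(a·t^n·dt) = d(a)·t^n·dt`) such that `e₀ ∘ Φ = id` and `e₁ ∘ Φ = F₁`, where
`e₀, e₁` are evaluation at `t = 0, 1` with `dt ↦ 0`. -/
noncomputable def IsHomotopicToId {k A : Type*} [Field k] [Ring A] [Algebra k A]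
    (ℬ : ℕ → Submodule k A) (d σ : A →ₗ[k] A) (F₁ : A → A) : Prop :=
  ∃ F G : A →ₗ[k] Polynomial A,
    (∀ a b : A, F (a * b) = F a * F b) ∧
    (∀ a b : A, G (a * b) = F a * G b + G a * cmap σ (F b)) ∧
    F 1 = 1 ∧ G 1 = 0 ∧
    (∀ a : A, F (d a) = cmap d (F a)) ∧
    (∀ a : A, G (d a) = Polynomial.derivative (cmap σ (F a)) + cmap d (G a)) ∧
    (∀ i : ℕ, ∀ a ∈ ℬ i, ∀ n : ℕ, (F a).coeff n ∈ ℬ i) ∧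
    (∀ i : ℕ, ∀ a ∈ ℬ i, ∀ n : ℕ, (G a).coeff n ∈ gpiece ℬ ((i : ℤ) - 1)) ∧
    (∀ a : A, (F a).coeff 0 = a) ∧
    (∀ a : A, Polynomial.eval 1 (F a) = F₁ a)

/-- The group of cdga automorphisms of `(A, ℬ, d)`: algebra automorphisms preserving
each graded piece and commuting with the differential. -/
def cdgaAut {k A : Type*} [Field k] [Ring A] [Algebra k A]
    (ℬ : ℕ → Submodule k A) (d : A →ₗ[k] A) : Subgroup (A ≃ₐ[k] A) where
  carrier := {F | (∀ i, ∀ a ∈ ℬ i, F a ∈ ℬ i) ∧ (∀ i, ∀ a ∈ ℬ i, F.symm a ∈ ℬ i) ∧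
    ∀ a, F (d a) = d (F a)}
  one_mem' := ⟨fun _ _ ha => ha, fun _ _ ha => ha, fun _ => rfl⟩
  mul_mem' := by
    rintro F G ⟨hF1, hF2, hF3⟩ ⟨hG1, hG2, hG3⟩
    refine ⟨fun i a ha => ?_, fun i a ha => ?_, fun a => ?_⟩
    · exact hF1 i _ (hG1 i a ha)
    · exact hG2 i _ (hF2 i a ha)
    · show F (G (d a)) = d (F (G a))
      rw [hG3, hF3]
  inv_mem' := by
    rintro F ⟨hF1, hF2, hF3⟩
    refine ⟨fun i a ha => ?_, fun i a ha => ?_, fun a => ?_⟩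
    · exact hF2 i a ha
    · exact hF1 i a ha
    · show F.symm (d a) = d (F.symm a)
      apply F.injective
      rw [AlgEquiv.apply_symm_apply, hF3, AlgEquiv.apply_symm_apply]

section CoefficientwiseMaps

open Polynomial

variable {k A : Type*} [Field k] [Ring A] [Algebra k A]

/-- The `t`-linear extension `A[t] → A[t]` of a linear map `A → A[t]`. -/
noncomputable def extendLinear (L : A →ₗ[k] A[X]) : A[X] →ₗ[k] A[X] :=
  Polynomial.lsum fun n => (LinearMap.mulRight k ((X : A[X]) ^ n)) ∘ₗ L

theorem extendLinear_monomial (L : A →ₗ[k] A[X]) (n : ℕ) (a : A) :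
    extendLinear L (monomial n a) = L a * X ^ n := by
  simp [extendLinear, Polynomial.lsum_apply, Polynomial.sum_monomial_index]

theorem coeff_cmap (f : A →ₗ[k] A) (p : A[X]) (n : ℕ) :
    (cmap f p).coeff n = f (p.coeff n) := by
  simp only [cmap, Polynomial.sum, finsetSum_coeff, coeff_C_mul_X_pow]
  rw [Finset.sum_ite_eq]
  split_ifs with h
  · rfl
  · rw [notMem_support_iff.mp h, map_zero]

theorem cmap_add (f : A →ₗ[k] A) (p q : A[X]) : cmap f (p + q) = cmap f p + cmap f q := by
  ext n; simp [coeff_cmap]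

theorem cmap_sub (f : A →ₗ[k] A) (p q : A[X]) : cmap f (p - q) = cmap f p - cmap f q := by
  ext n; simp [coeff_cmap]

theorem cmap_neg (f : A →ₗ[k] A) (p : A[X]) : cmap f (-p) = -cmap f p := by
  ext n; simp [coeff_cmap]

theorem cmap_smul (f : A →ₗ[k] A) (c : k) (p : A[X]) : cmap f (c • p) = c • cmap f p := by
  ext n; simp [coeff_cmap]

theorem cmap_monomial (f : A →ₗ[k] A) (n : ℕ) (a : A) :
    cmap f (monomial n a) = monomial n (f a) := by
  ext m; simp only [coeff_cmap, coeff_monomial]; split_ifs <;> simp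

theorem cmap_C (f : A →ₗ[k] A) (a : A) : cmap f (C a) = C (f a) := cmap_monomial f 0 a

theorem cmap_mul_X (f : A →ₗ[k] A) (p : A[X]) : cmap f (p * X) = cmap f p * X := by
  ext n; cases n <;> simp [coeff_cmap]

theorem cmap_mul_X_pow (f : A →ₗ[k] A) (p : A[X]) (n : ℕ) :
    cmap f (p * X ^ n) = cmap f p * X ^ n := by
  induction n with
  | zero => simp
  | succ n ih => rw [pow_succ, ← mul_assoc, cmap_mul_X, ih, mul_assoc]

theorem derivative_cmap (f : A →ₗ[k] A) (p : A[X]) :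
    derivative (cmap f p) = cmap f (derivative p) := by
  ext n
  simp only [coeff_derivative, coeff_cmap]
  have h : ∀ a : A, a * ((n : A) + 1) = (n + 1) • a := fun a => by
    rw [nsmul_eq_mul', Nat.cast_add_one]
  rw [h, h, map_nsmul]

theorem eval_one_cmap (f : A →ₗ[k] A) (p : A[X]) : eval 1 (cmap f p) = f (eval 1 p) := by
  induction p using Polynomial.induction_on' with
  | add p q hp hq => simp [cmap_add, hp, hq]
  | monomial n a => simp [cmap_monomial]

theorem cmap_algEquiv_mul (φ : A ≃ₐ[k] A) (p q : A[X]) :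
    cmap φ.toLinearMap (p * q) = cmap φ.toLinearMap p * cmap φ.toLinearMap q := by
  ext n; simp [coeff_cmap, coeff_mul]

theorem extendLinear_mul_of_map_mul (L : A →ₗ[k] A[X]) (hL : ∀ a b, L (a * b) = L a * L b)
    (p q : A[X]) : extendLinear L (p * q) = extendLinear L p * extendLinear L q := by
  induction p using Polynomial.induction_on' with
  | add p p' hp hp' => simp [add_mul, hp, hp']
  | monomial n a =>
    induction q using Polynomial.induction_on' with
    | add q q' hq hq' => simp [mul_add, hq, hq']
    | monomial m b =>
      rw [monomial_mul_monomial]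
      simp only [extendLinear_monomial, hL, pow_add, mul_assoc]
      rw [← mul_assoc (X ^ n) (L b), (commute_X_pow (L b) n).eq, mul_assoc]

theorem extendLinear_mul_of_twisted (σ : A →ₗ[k] A) (F G : A →ₗ[k] A[X])
    (h : ∀ a b, G (a * b) = F a * G b + G a * cmap σ (F b)) (p q : A[X]) :
    extendLinear G (p * q) =
      extendLinear F p * extendLinear G q + extendLinear G p * cmap σ (extendLinear F q) := by
  induction p using Polynomial.induction_on' with
  | add p p' hp hp' => simp only [add_mul, map_add, hp, hp']; abel
  | monomial n a =>
    induction q using Polynomial.induction_on' with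
    | add q q' hq hq' => simp only [mul_add, map_add, cmap_add, hq, hq']; abel
    | monomial m b =>
      rw [monomial_mul_monomial]
      simp only [extendLinear_monomial, h, pow_add, add_mul, cmap_mul_X_pow, mul_assoc]
      rw [← mul_assoc (X ^ n) (G b), (commute_X_pow (G b) n).eq, ← mul_assoc (X ^ n) (cmap _ _),
        (commute_X_pow (cmap σ (F b)) n).eq, mul_assoc, mul_assoc]

theorem extendLinear_cmap (L : A →ₗ[k] A[X]) (f : A →ₗ[k] A)
    (h : ∀ a, L (f a) = cmap f (L a)) (p : A[X]) :
    extendLinear L (cmap f p) = cmap f (extendLinear L p) := by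
  induction p using Polynomial.induction_on' with
  | add p q hp hq => simp [cmap_add, hp, hq]
  | monomial n a => simp [cmap_monomial, extendLinear_monomial, h, cmap_mul_X_pow]

/-- If `F + G dt` commutes with the differentials, so does its `k[t,dt]`-linear extension. -/
theorem extendLinear_cmap_of_derivative (d σ : A →ₗ[k] A) (F G : A →ₗ[k] A[X])
    (h : ∀ a, G (d a) = derivative (cmap σ (F a)) + cmap d (G a)) (p : A[X]) :
    extendLinear G (cmap d p) + cmap σ (extendLinear F (derivative p)) =
      derivative (cmap σ (extendLinear F p)) + cmap d (extendLinear G p) := by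
  induction p using Polynomial.induction_on' with
  | add p q hp hq =>
    simp only [cmap_add, map_add]
    rw [add_add_add_comm, hp, hq]; abel
  | monomial n a =>
    have hn : monomial (n - 1) (a * (n : A)) = (n : k) • monomial (n - 1) a := by
      rw [smul_monomial, Algebra.smul_def, map_natCast, (Nat.cast_commute n a).eq]
    rw [cmap_monomial, derivative_monomial, hn, map_smul, cmap_smul]
    simp only [extendLinear_monomial, h, cmap_mul_X_pow, derivative_mul, derivative_X_pow]
    have hX : cmap σ (F a) * (C (n : A) * X ^ (n - 1)) = (n : k) • (cmap σ (F a) * X ^ (n - 1)) := by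
      rw [Algebra.smul_def, map_natCast, map_natCast, ← mul_assoc, ← mul_assoc,
        (Nat.cast_commute n (cmap σ (F a))).eq]
    rw [hX, add_mul]
    abel

theorem coeff_extendLinear_mem (L : A →ₗ[k] A[X]) (S T : Submodule k A)
    (h : ∀ a ∈ S, ∀ n, (L a).coeff n ∈ T) (p : A[X]) (hp : ∀ n, p.coeff n ∈ S) (m : ℕ) :
    (extendLinear L p).coeff m ∈ T := by
  rw [p.as_sum_support, map_sum, finsetSum_coeff]
  refine T.sum_mem fun i _ => ?_
  rw [extendLinear_monomial, coeff_mul_X_pow']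
  split_ifs
  · exact h _ (hp i) _
  · exact T.zero_mem

theorem coeff_zero_extendLinear (L : A →ₗ[k] A[X]) (h : ∀ a, (L a).coeff 0 = a) (p : A[X]) :
    (extendLinear L p).coeff 0 = p.coeff 0 := by
  induction p using Polynomial.induction_on' with
  | add p q hp hq => simp [hp, hq]
  | monomial n a =>
    rw [extendLinear_monomial]
    cases n <;> simp [h, coeff_monomial, pow_succ, ← mul_assoc]

theorem eval_one_extendLinear (L : A →ₗ[k] A[X]) (f : A →ₗ[k] A)
    (h : ∀ a, eval 1 (L a) = f a) (p : A[X]) :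
    eval 1 (extendLinear L p) = f (eval 1 p) := by
  induction p using Polynomial.induction_on' with
  | add p q hp hq => simp [hp, hq]
  | monomial n a =>
    rw [extendLinear_monomial, ← h]
    simp [eval_mul_X_pow]

/-- The substitution `t ↦ 1 - t` on `A[t]`. -/
noncomputable def reverseTime : A[X] →ₗ[k] A[X] :=
  Polynomial.lsum fun n => (LinearMap.mulRight k ((1 - X : A[X]) ^ n)) ∘ₗ
    ((monomial 0).restrictScalars k : A →ₗ[k] A[X])

theorem reverseTime_monomial (n : ℕ) (a : A) :
    reverseTime (k := k) (monomial n a) = C a * (1 - X) ^ n := by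
  simp [reverseTime, Polynomial.lsum_apply, Polynomial.sum_monomial_index]

theorem commute_one_sub_X_pow (p : A[X]) (n : ℕ) : Commute ((1 - X : A[X]) ^ n) p :=
  ((Commute.one_left p).sub_left (commute_X p)).pow_left n

theorem reverseTime_mul (p q : A[X]) :
    reverseTime (k := k) (p * q) = reverseTime (k := k) p * reverseTime (k := k) q := by
  induction p using Polynomial.induction_on' with
  | add p p' hp hp' => simp [add_mul, hp, hp']
  | monomial n a =>
    induction q using Polynomial.induction_on' with
    | add q q' hq hq' => simp [mul_add, hq, hq']
    | monomial m b =>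
      rw [monomial_mul_monomial]
      simp only [reverseTime_monomial, C_mul, pow_add, mul_assoc]
      rw [← mul_assoc (_ ^ n) (C b), (commute_one_sub_X_pow (C b) n).eq, mul_assoc]

theorem reverseTime_one : reverseTime (k := k) (1 : A[X]) = 1 := by
  simpa using reverseTime_monomial (k := k) 0 (1 : A)

theorem cmap_mul_one_sub_X_pow (f : A →ₗ[k] A) (p : A[X]) (n : ℕ) :
    cmap f (p * (1 - X) ^ n) = cmap f p * (1 - X) ^ n := by
  induction n with
  | zero => simp
  | succ n ih =>
    rw [pow_succ, ← mul_assoc, mul_sub, mul_one, cmap_sub, cmap_mul_X, ih, ← mul_assoc, mul_sub,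
      mul_one]

theorem reverseTime_cmap (f : A →ₗ[k] A) (p : A[X]) :
    reverseTime (k := k) (cmap f p) = cmap f (reverseTime (k := k) p) := by
  induction p using Polynomial.induction_on' with
  | add p q hp hq => simp [cmap_add, hp, hq]
  | monomial n a => simp [cmap_monomial, reverseTime_monomial, cmap_mul_one_sub_X_pow, cmap_C]

theorem derivative_one_sub_X_pow (n : ℕ) :
    derivative ((1 - X : A[X]) ^ n) = -((n : A[X]) * (1 - X) ^ (n - 1)) := by
  induction n with
  | zero => simp
  | succ n ih =>
    rw [pow_succ, derivative_mul, ih]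
    cases n with
    | zero => simp
    | succ n =>
      simp only [Nat.add_sub_cancel, derivative_sub, derivative_one, derivative_X, pow_succ]
      push_cast
      noncomm_ring

theorem derivative_reverseTime (p : A[X]) :
    derivative (reverseTime (k := k) p) = -reverseTime (k := k) (derivative p) := by
  induction p using Polynomial.induction_on' with
  | add p q hp hq => simp only [map_add, hp, hq]; abel
  | monomial n a =>
    rw [derivative_monomial, reverseTime_monomial, reverseTime_monomial, derivative_C_mul,
      derivative_one_sub_X_pow, C_mul, map_natCast, mul_neg, mul_assoc]

theorem coeff_mul_one_sub_X_pow_mem (S : Submodule k A) (p : A[X]) (hp : ∀ n, p.coeff n ∈ S)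
    (n m : ℕ) : (p * (1 - X) ^ n).coeff m ∈ S := by
  induction n generalizing m with
  | zero => simpa using hp m
  | succ n ih =>
    rw [pow_succ, ← mul_assoc, mul_sub, mul_one, coeff_sub]
    refine S.sub_mem (ih m) ?_
    cases m with
    | zero => simp
    | succ m => rw [coeff_mul_X]; exact ih m

theorem coeff_reverseTime_mem (S : Submodule k A) (p : A[X]) (hp : ∀ n, p.coeff n ∈ S) (m : ℕ) :
    (reverseTime (k := k) p).coeff m ∈ S := by
  rw [p.as_sum_support, map_sum, finsetSum_coeff]
  refine S.sum_mem fun i _ => ?_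
  rw [reverseTime_monomial]
  refine coeff_mul_one_sub_X_pow_mem S _ (fun n => ?_) i m
  rw [coeff_C]
  split_ifs
  · exact hp i
  · exact S.zero_mem

theorem coeff_zero_reverseTime (p : A[X]) : (reverseTime (k := k) p).coeff 0 = eval 1 p := by
  induction p using Polynomial.induction_on' with
  | add p q hp hq => simp [hp, hq]
  | monomial n a =>
    rw [reverseTime_monomial, coeff_C_mul, coeff_zero_eq_eval_zero]
    have h : eval 0 ((1 - X : A[X]) ^ n) = 1 := by
      induction n with
      | zero => simp
      | succ n ih => rw [pow_succ, mul_sub, mul_one, eval_sub, ih, eval_mul_X]; simp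
    rw [h]; simp

theorem eval_one_reverseTime (p : A[X]) : eval 1 (reverseTime (k := k) p) = p.coeff 0 := by
  induction p using Polynomial.induction_on' with
  | add p q hp hq => simp [hp, hq]
  | monomial n a =>
    rw [reverseTime_monomial]
    cases n with
    | zero => simp
    | succ n => rw [pow_succ, ← mul_assoc, mul_sub, mul_one, eval_sub, eval_mul_X]; simp

end CoefficientwiseMaps

section Homotopies

open Polynomial

variable {k A : Type*} [Field k] [Ring A] [Algebra k A]

/-- `F + G dt : A → A[t,dt]` is a dga homomorphism. -/
structure IsCdgaHomotopy (ℬ : ℕ → Submodule k A) (d σ : A →ₗ[k] A) (F G : A →ₗ[k] A[X]) :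
    Prop where
  map_mul : ∀ a b : A, F (a * b) = F a * F b
  map_mul_dt : ∀ a b : A, G (a * b) = F a * G b + G a * cmap σ (F b)
  map_one : F 1 = 1
  map_one_dt : G 1 = 0
  map_d : ∀ a : A, F (d a) = cmap d (F a)
  map_d_dt : ∀ a : A, G (d a) = derivative (cmap σ (F a)) + cmap d (G a)
  coeff_mem : ∀ i : ℕ, ∀ a ∈ ℬ i, ∀ n : ℕ, (F a).coeff n ∈ ℬ i
  coeff_mem_dt : ∀ i : ℕ, ∀ a ∈ ℬ i, ∀ n : ℕ, (G a).coeff n ∈ gpiece ℬ ((i : ℤ) - 1)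

theorem isHomotopicToId_iff {ℬ : ℕ → Submodule k A} {d σ : A →ₗ[k] A} {f : A → A} :
    IsHomotopicToId ℬ d σ f ↔ ∃ F G : A →ₗ[k] A[X], IsCdgaHomotopy ℬ d σ F G ∧
      (∀ a, (F a).coeff 0 = a) ∧ ∀ a, eval 1 (F a) = f a := by
  constructor
  · rintro ⟨F, G, h1, h2, h3, h4, h5, h6, h7, h8, h9, h10⟩
    exact ⟨F, G, ⟨h1, h2, h3, h4, h5, h6, h7, h8⟩, h9, h10⟩
  · rintro ⟨F, G, ⟨h1, h2, h3, h4, h5, h6, h7, h8⟩, h9, h10⟩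
    exact ⟨F, G, h1, h2, h3, h4, h5, h6, h7, h8, h9, h10⟩

theorem mem_gpiece_of_forall_mem {M : Type*} {ℬ : ℕ → Submodule k A} {f : A → M}
    {P : M → Submodule k A → Prop} (hbot : P (f 0) ⊥)
    (h : ∀ i, ∀ a ∈ ℬ i, P (f a) (ℬ i)) (n : ℤ) {a : A} (ha : a ∈ gpiece ℬ n) :
    P (f a) (gpiece ℬ n) := by
  unfold gpiece at ha ⊢
  split_ifs at ha ⊢ with hn
  · exact h _ a ha
  · rw [(Submodule.mem_bot k).mp ha]; exact hbot

theorem linearMap_eq_of_forall_mem {M : Type*} [AddCommGroup M] [Module k M]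
    {ℬ : ℕ → Submodule k A} (hinternal : DirectSum.IsInternal ℬ) {f g : A →ₗ[k] M}
    (h : ∀ i, ∀ a ∈ ℬ i, f a = g a) (a : A) : f a = g a := by
  have ha : a ∈ ⨆ i, ℬ i := hinternal.submodule_iSup_eq_top ▸ Submodule.mem_top
  induction ha using Submodule.iSup_induction' with
  | mem i x hx => exact h i x hx
  | zero => simp
  | add x y _ _ hx hy => simp [hx, hy]

variable {ℬ : ℕ → Submodule k A} {d σ : A →ₗ[k] A}

/-- A degree-preserving map `A → A[t]` commutes with the sign involution. -/
theorem map_sign_of_coeff_mem (hinternal : DirectSum.IsInternal ℬ)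
    (hσ : ∀ i, ∀ a ∈ ℬ i, σ a = ((-1 : k) ^ i) • a) {F : A →ₗ[k] A[X]}
    (hF : ∀ i, ∀ a ∈ ℬ i, ∀ n, (F a).coeff n ∈ ℬ i) (a : A) : F (σ a) = cmap σ (F a) := by
  ext n
  rw [coeff_cmap]
  let c : A[X] →ₗ[k] A := (lcoeff A n).restrictScalars k
  refine linearMap_eq_of_forall_mem hinternal (f := c ∘ₗ F ∘ₗ σ) (g := σ ∘ₗ c ∘ₗ F)
    (fun i a ha => ?_) a
  change (F (σ a)).coeff n = σ ((F a).coeff n)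
  rw [hσ i a ha, map_smul, coeff_smul, hσ i _ (hF i a ha n)]

theorem map_sign_of_mem (hinternal : DirectSum.IsInternal ℬ)
    (hσ : ∀ i, ∀ a ∈ ℬ i, σ a = ((-1 : k) ^ i) • a) {f : A →ₗ[k] A}
    (hf : ∀ i, ∀ a ∈ ℬ i, f a ∈ ℬ i) (a : A) : f (σ a) = σ (f a) := by
  refine linearMap_eq_of_forall_mem hinternal (f := f ∘ₗ σ) (g := σ ∘ₗ f) (fun i a ha => ?_) a
  simp [hσ i a ha, hσ i _ (hf i a ha)]

theorem cmap_comm {f g : A →ₗ[k] A} (h : ∀ a, f (g a) = g (f a)) (p : A[X]) :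
    cmap f (cmap g p) = cmap g (cmap f p) := by
  ext n; simp [coeff_cmap, h]

/-- `cmap` bundled as a linear map. -/
noncomputable def cmapLinear (f : A →ₗ[k] A) : A[X] →ₗ[k] A[X] where
  toFun := cmap f
  map_add' := cmap_add f
  map_smul' := cmap_smul f

namespace IsCdgaHomotopy

variable (ℬ d σ) in
theorem const : IsCdgaHomotopy ℬ d σ ((monomial 0).restrictScalars k) 0 where
  map_mul a b := by simp
  map_mul_dt a b := by simp
  map_one := by simp
  map_one_dt := by simp
  map_d a := by simp [cmap_C]
  map_d_dt a := by
    have h : cmap d (0 : A[X]) = 0 := by ext n; simp [coeff_cmap]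
    simp [cmap_C, h]
  coeff_mem i a ha n := by
    simp only [LinearMap.coe_restrictScalars, coeff_monomial]
    split_ifs
    · exact ha
    · exact (ℬ i).zero_mem
  coeff_mem_dt i a _ n := by simp

variable {F G F' G' : A →ₗ[k] A[X]}

/-- Precomposition with a cdga automorphism. -/
theorem comp_aut (h : IsCdgaHomotopy ℬ d σ F G) {φ : A ≃ₐ[k] A} (hφ : φ ∈ cdgaAut ℬ d) :
    IsCdgaHomotopy ℬ d σ (F ∘ₗ φ.toLinearMap) (G ∘ₗ φ.toLinearMap) where
  map_mul a b := by simp [h.map_mul]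
  map_mul_dt a b := by simp [h.map_mul_dt]
  map_one := by simp [h.map_one]
  map_one_dt := by simp [h.map_one_dt]
  map_d a := by simp [hφ.2.2, h.map_d]
  map_d_dt a := by simp [hφ.2.2, h.map_d_dt]
  coeff_mem i a ha := h.coeff_mem i _ (hφ.1 i a ha)
  coeff_mem_dt i a ha := h.coeff_mem_dt i _ (hφ.1 i a ha)

/-- Postcomposition with a cdga automorphism, extended `k[t,dt]`-linearly. -/
theorem aut_comp (hinternal : DirectSum.IsInternal ℬ)
    (hσ : ∀ i, ∀ a ∈ ℬ i, σ a = ((-1 : k) ^ i) • a)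
    (h : IsCdgaHomotopy ℬ d σ F G) {φ : A ≃ₐ[k] A} (hφ : φ ∈ cdgaAut ℬ d) :
    IsCdgaHomotopy ℬ d σ (cmapLinear φ.toLinearMap ∘ₗ F) (cmapLinear φ.toLinearMap ∘ₗ G) := by
  have hφσ := cmap_comm (map_sign_of_mem hinternal hσ (f := φ.toLinearMap) hφ.1)
  have hφd := cmap_comm (f := φ.toLinearMap) (g := d) hφ.2.2
  constructor
  · intro a b
    exact (congrArg _ (h.map_mul a b)).trans (cmap_algEquiv_mul φ _ _)
  · intro a b
    change cmap _ (G (a * b)) = cmap _ (F a) * cmap _ (G b) + cmap _ (G a) * cmap σ (cmap _ (F b))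
    rw [h.map_mul_dt, cmap_add, cmap_algEquiv_mul, cmap_algEquiv_mul, hφσ]
  · change cmap _ (F 1) = 1
    rw [h.map_one, ← C_1, cmap_C]; simp
  · change cmapLinear _ (G 1) = 0
    rw [h.map_one_dt, map_zero]
  · intro a
    change cmap _ (F (d a)) = cmap d (cmap _ (F a))
    rw [h.map_d, hφd]
  · intro a
    change cmap _ (G (d a)) = derivative (cmap σ (cmap _ (F a))) + cmap d (cmap _ (G a))
    rw [h.map_d_dt, cmap_add, hφd, ← derivative_cmap, hφσ]
  · intro i a ha n
    change (cmap _ (F a)).coeff n ∈ _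
    rw [coeff_cmap]
    exact hφ.1 i _ (h.coeff_mem i a ha n)
  · intro i a ha n
    change (cmap _ (G a)).coeff n ∈ _
    rw [coeff_cmap]
    exact mem_gpiece_of_forall_mem (f := φ) (P := fun b S => b ∈ S) (by simp) hφ.1 _
      (h.coeff_mem_dt i a ha n)

/-- The homotopy run backwards, by the substitution `t ↦ 1 - t`, `dt ↦ -dt`. -/
theorem reverse (h : IsCdgaHomotopy ℬ d σ F G) :
    IsCdgaHomotopy ℬ d σ (reverseTime ∘ₗ F) (-(reverseTime ∘ₗ G)) where
  map_mul a b := by simp [h.map_mul, reverseTime_mul]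
  map_mul_dt a b := by
    simp only [LinearMap.neg_apply, LinearMap.comp_apply, h.map_mul_dt, map_add, reverseTime_mul,
      reverseTime_cmap]
    noncomm_ring
  map_one := by simp [h.map_one, reverseTime_one]
  map_one_dt := by simp [h.map_one_dt]
  map_d a := by simp [h.map_d, reverseTime_cmap]
  map_d_dt a := by
    simp only [LinearMap.neg_apply, LinearMap.comp_apply, h.map_d_dt, map_add, cmap_neg,
      ← reverseTime_cmap, derivative_reverseTime]
    abel
  coeff_mem i a ha n := coeff_reverseTime_mem _ _ (h.coeff_mem i a ha) n
  coeff_mem_dt i a ha n := by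
    rw [LinearMap.neg_apply, coeff_neg]
    exact Submodule.neg_mem _ (coeff_reverseTime_mem _ _ (h.coeff_mem_dt i a ha) n)

/-- The composite of `F' + G' dt` with the `k[t,dt]`-linear extension of `F + G dt`. -/
theorem comp (hinternal : DirectSum.IsInternal ℬ)
    (hσ : ∀ i, ∀ a ∈ ℬ i, σ a = ((-1 : k) ^ i) • a)
    (h : IsCdgaHomotopy ℬ d σ F G) (h' : IsCdgaHomotopy ℬ d σ F' G') :
    IsCdgaHomotopy ℬ d σ (extendLinear F ∘ₗ F')
      (extendLinear G ∘ₗ F' + extendLinear F ∘ₗ G') := by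
  have hFmul := extendLinear_mul_of_map_mul F h.map_mul
  have hFσ := extendLinear_cmap F σ (map_sign_of_coeff_mem hinternal hσ h.coeff_mem)
  have hFd := extendLinear_cmap F d h.map_d
  have hone : ∀ L : A →ₗ[k] A[X], extendLinear L 1 = L 1 := fun L => by
    simpa using extendLinear_monomial L 0 1
  constructor
  · intro a b
    simp [h'.map_mul, hFmul]
  · intro a b
    simp only [LinearMap.add_apply, LinearMap.comp_apply, h'.map_mul, h'.map_mul_dt, map_add,
      extendLinear_mul_of_twisted σ F G h.map_mul_dt, hFmul, hFσ, mul_add, add_mul]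
    abel
  · simp [h'.map_one, hone, h.map_one]
  · simp [h'.map_one, h'.map_one_dt, hone, h.map_one_dt]
  · intro a
    simp [h'.map_d, hFd]
  · intro a
    simp only [LinearMap.add_apply, LinearMap.comp_apply, h'.map_d, h'.map_d_dt, map_add, cmap_add]
    rw [← add_assoc, ← add_assoc, ← extendLinear_cmap_of_derivative d σ F G h.map_d_dt,
      derivative_cmap, hFσ, hFd]
  · intro i a ha n
    exact coeff_extendLinear_mem F _ _ (h.coeff_mem i) _ (h'.coeff_mem i a ha) n
  · intro i a ha n
    rw [LinearMap.add_apply, coeff_add]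
    refine Submodule.add_mem _ ?_ ?_
    · exact coeff_extendLinear_mem G _ _ (h.coeff_mem_dt i) _ (h'.coeff_mem i a ha) n
    · refine coeff_extendLinear_mem F _ _ (fun b hb => ?_) _ (h'.coeff_mem_dt i a ha) n
      exact mem_gpiece_of_forall_mem (f := F) (P := fun p S => ∀ n, p.coeff n ∈ S) (by simp)
        h.coeff_mem _ hb

end IsCdgaHomotopy

theorem isHomotopicToId_id : IsHomotopicToId ℬ d σ id :=
  isHomotopicToId_iff.mpr ⟨_, _, IsCdgaHomotopy.const ℬ d σ, by simp, by simp⟩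

theorem IsHomotopicToId.comp (hinternal : DirectSum.IsInternal ℬ)
    (hσ : ∀ i, ∀ a ∈ ℬ i, σ a = ((-1 : k) ^ i) • a) {f : A →ₗ[k] A} {g : A → A}
    (hf : IsHomotopicToId ℬ d σ f) (hg : IsHomotopicToId ℬ d σ g) :
    IsHomotopicToId ℬ d σ (f ∘ g) := by
  obtain ⟨F, G, h, h0, h1⟩ := isHomotopicToId_iff.mp hf
  obtain ⟨F', G', h', h0', h1'⟩ := isHomotopicToId_iff.mp hg
  refine isHomotopicToId_iff.mpr ⟨_, _, h.comp hinternal hσ h', fun a => ?_, fun a => ?_⟩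
  · rw [LinearMap.comp_apply, coeff_zero_extendLinear F h0, h0']
  · rw [LinearMap.comp_apply, eval_one_extendLinear F f h1, h1', Function.comp_apply]

theorem IsHomotopicToId.symm (hinternal : DirectSum.IsInternal ℬ)
    (hσ : ∀ i, ∀ a ∈ ℬ i, σ a = ((-1 : k) ^ i) • a) {f : A ≃ₐ[k] A} (hf : f ∈ cdgaAut ℬ d)
    (hhom : IsHomotopicToId ℬ d σ f) : IsHomotopicToId ℬ d σ f.symm := by
  obtain ⟨F, G, h, h0, h1⟩ := isHomotopicToId_iff.mp hhom
  have hf' : f.symm ∈ cdgaAut ℬ d := (cdgaAut ℬ d).inv_mem hf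
  refine isHomotopicToId_iff.mpr ⟨_, _, (h.aut_comp hinternal hσ hf').reverse,
    fun a => ?_, fun a => ?_⟩
  · rw [LinearMap.comp_apply, coeff_zero_reverseTime]
    exact (eval_one_cmap _ _).trans (by simp [h1])
  · rw [LinearMap.comp_apply, eval_one_reverseTime]
    exact (coeff_cmap _ _ _).trans (by simp [h0])

theorem IsHomotopicToId.conj (hinternal : DirectSum.IsInternal ℬ)
    (hσ : ∀ i, ∀ a ∈ ℬ i, σ a = ((-1 : k) ^ i) • a) {f φ : A ≃ₐ[k] A} (hφ : φ ∈ cdgaAut ℬ d)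
    (hhom : IsHomotopicToId ℬ d σ f) : IsHomotopicToId ℬ d σ (φ * f * φ⁻¹ : A ≃ₐ[k] A) := by
  obtain ⟨F, G, h, h0, h1⟩ := isHomotopicToId_iff.mp hhom
  have hφ' : φ⁻¹ ∈ cdgaAut ℬ d := (cdgaAut ℬ d).inv_mem hφ
  refine isHomotopicToId_iff.mpr ⟨_, _, (h.aut_comp hinternal hσ hφ).comp_aut hφ',
    fun a => ?_, fun a => ?_⟩
  · refine (coeff_cmap _ _ _).trans ?_
    rw [h0]
    exact φ.apply_symm_apply a
  · refine (eval_one_cmap _ _).trans ?_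
    rw [h1]
    rfl

end Homotopies

/-- for a Sullivan algebra `(A, ℬ, d)` over a field of characteristic zero,
the cdga automorphisms homotopic to the identity form a normal subgroup of the group of
all cdga automorphisms. -/
theorem homotopic_to_id_normal_subgroup
    {k A : Type*} [Field k] [CharZero k] [Ring A] [Algebra k A]
    (ℬ : ℕ → Submodule k A)
    (hinternal : DirectSum.IsInternal ℬ)
    (hconn : ℬ 0 = 1)
    (hgmul : ∀ i j, ℬ i * ℬ j ≤ ℬ (i + j))
    (hcomm : ∀ i j, ∀ a ∈ ℬ i, ∀ b ∈ ℬ j, a * b = ((-1 : k) ^ (i * j)) • (b * a))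
    (d : A →ₗ[k] A)
    (hd_deg : ∀ i, ∀ a ∈ ℬ i, d a ∈ ℬ (i + 1))
    (hd_sq : ∀ a, d (d a) = 0)
    (hd_leib : ∀ i, ∀ a ∈ ℬ i, ∀ b, d (a * b) = d a * b + ((-1 : k) ^ i) • (a * d b))
    (σ : A →ₗ[k] A) (hσ : ∀ i, ∀ a ∈ ℬ i, σ a = ((-1 : k) ^ i) • a)
    -- Sullivan condition: a well-ordered family of free generators
    (I : Type*) [LinearOrder I] [WellFoundedLT I]
    (deg : I → ℕ) (hdeg_pos : ∀ α, 0 < deg α)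
    (x : I → A) (hx : ∀ α, x α ∈ ℬ (deg α))
    (e : (MvPolynomial {α : I // Even (deg α)} k ⊗[k]
        ExteriorAlgebra k ({α : I // Odd (deg α)} →₀ k)) ≃ₐ[k] A)
    (he_even : ∀ β : {α : I // Even (deg α)},
      e (MvPolynomial.X β ⊗ₜ[k] 1) = x β)
    (he_odd : ∀ β : {α : I // Odd (deg α)},
      e (1 ⊗ₜ[k] ExteriorAlgebra.ι k (Finsupp.single β 1)) = x β)
    (hdx : ∀ α : I, d (x α) ∈ Algebra.adjoin k (x '' {β : I | β < α})) :
    ∃ N : Subgroup ↥(cdgaAut ℬ d),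
      (∀ F : ↥(cdgaAut ℬ d), F ∈ N ↔ IsHomotopicToId ℬ d σ ⇑(F : A ≃ₐ[k] A)) ∧
      N.Normal := by
  refine ⟨{ carrier := {F | IsHomotopicToId ℬ d σ ⇑(F : A ≃ₐ[k] A)}
            one_mem' := isHomotopicToId_id
            mul_mem' := fun {f g} hf hg =>
              IsHomotopicToId.comp hinternal hσ (f := (f : A ≃ₐ[k] A).toLinearMap) hf hg
            inv_mem' := fun {f} hf => IsHomotopicToId.symm hinternal hσ f.2 hf },
    fun F => Iff.rfl, ⟨fun f hf φ => IsHomotopicToId.conj hinternal hσ φ.2 hf⟩⟩
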